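/- arXiv:1608.06185 — 2 statements merged into one kernel-verified Lean document; each statement's English description precedes it below -/
import Mathlib

section
/- Define the real sequence a by a(1) = √2 and a(m+1) = √(2 + a(m)) for m ≥ 1. Then the sequence M ↦ (1 / 2^M) · U_{2^M - 1}(a(M) / 2) converges, as M → ∞, to 2/π. -/
/-- A sequence satisfying the nested-radical recursion from `√2` agrees with
`Real.sqrtTwoAddSeries 0` at every positive index. -/
lemma eq_sqrtTwoAddSeries_of_recursion (a : ℕ → ℝ) (ha1 : a 1 = Real.sqrt 2)
    (ha : ∀ m : ℕ, 1 ≤ m → a (m + 1) = Real.sqrt (2 + a m)) {m : ℕ} (hm : 1 ≤ m) :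
    a m = Real.sqrtTwoAddSeries 0 m := by
  induction m, hm using Nat.le_induction with
  | base => rw [ha1, Real.sqrtTwoAddSeries_one]
  | succ m hm ih => rw [ha m hm, ih, Real.sqrtTwoAddSeries]

/-- The normalized Chebyshev value at `cos (π / 2 ^ (M + 1))` in terms of `Real.sinc`. -/
lemma eval_chebyshevU_cos_pi_over_two_pow (M : ℕ) :
    (1 / 2 ^ M : ℝ) * (Polynomial.Chebyshev.U ℝ ((2 : ℤ) ^ M - 1)).eval
        (Real.cos (Real.pi / 2 ^ (M + 1))) =
      2 / Real.pi / Real.sinc (Real.pi / 2 ^ (M + 1)) := by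
  set θ := Real.pi / 2 ^ (M + 1) with hθ
  have hθ_pos : 0 < θ := by positivity
  have hθ_lt : θ < Real.pi :=
    div_lt_self Real.pi_pos (one_lt_pow₀ one_lt_two M.succ_ne_zero)
  have hsin : Real.sin θ ≠ 0 := (Real.sin_pos_of_pos_of_lt_pi hθ_pos hθ_lt).ne'
  have hpi : (2 : ℝ) ^ M * θ = Real.pi / 2 := by
    rw [hθ, pow_succ]
    field_simp
  have hU := Polynomial.Chebyshev.U_real_cos θ ((2 : ℤ) ^ M - 1)
  push_cast at hU
  rw [sub_add_cancel, hpi, Real.sin_pi_div_two] at hU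
  rw [eq_div_of_mul_eq hsin hU, Real.sinc_of_ne_zero hθ_pos.ne', div_div_eq_mul_div]
  have hπ := Real.pi_ne_zero
  field_simp
  linear_combination -2 * hpi

theorem viete_chebyshevU_formula_pi (a : ℕ → ℝ) (ha1 : a 1 = Real.sqrt 2)
    (ha : ∀ m : ℕ, 1 ≤ m → a (m + 1) = Real.sqrt (2 + a m)) :
    Filter.Tendsto
      (fun M : ℕ => (1 / 2 ^ M : ℝ) *
        (Polynomial.Chebyshev.U ℝ ((2 : ℤ) ^ M - 1)).eval (a M / 2))
      Filter.atTop (nhds (2 / Real.pi)) := by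
  have hθ : Filter.Tendsto (fun M : ℕ => Real.pi / (2 : ℝ) ^ (M + 1)) Filter.atTop (nhds 0) :=
    ((tendsto_pow_atTop_atTop_of_one_lt one_lt_two).comp
      (Filter.tendsto_add_atTop_nat 1)).const_div_atTop Real.pi
  have hsinc : Filter.Tendsto (fun M : ℕ => Real.sinc (Real.pi / (2 : ℝ) ^ (M + 1)))
      Filter.atTop (nhds 1) := by
    simpa [Function.comp_def] using (Real.continuous_sinc.tendsto 0).comp hθ
  have hlim := (tendsto_const_nhds (x := 2 / Real.pi)).div hsinc one_ne_zero
  rw [div_one] at hlim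
  refine hlim.congr' ?_
  filter_upwards [Filter.eventually_ge_atTop 1] with M hM
  rw [eq_sqrtTwoAddSeries_of_recursion a ha1 ha hM, ← Real.cos_pi_over_two_pow,
    eval_chebyshevU_cos_pi_over_two_pow]
  rfl
end

section
/- For every real number t with |t| ≤ 10 and t ≠ 0, the approximation error |sin(t)/t − (1/16)·U_{15}(cos(t/16))| is strictly less than 0.006, where (1/16)·U_{15}(cos(t/16)) = 2048·cos^{15}(t/16) − 7168·cos^{13}(t/16) + 9984·cos^{11}(t/16) − 7040·cos^{9}(t/16) + 2640·cos^{7}(t/16) − 504·cos^{5}(t/16) + 42·cos^{3}(t/16) − cos(t/16). -/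
/-- A lower bound for `sin` gives an upper bound for `1 / sin x - 1 / x`. -/
theorem inv_sin_sub_inv_le {x c : ℝ} (hx : 0 < x) (hx1 : x ≤ 1)
    (h : x / 6 ≤ c * (1 - x ^ 2 / 6)) : (Real.sin x)⁻¹ - x⁻¹ ≤ c := by
  have hs : x * (1 - x ^ 2 / 6) ≤ Real.sin x := by
    have := Real.sin_ge_sub_cube hx.le
    linarith
  have hp : 0 < 1 - x ^ 2 / 6 := by nlinarith
  have hinv : (Real.sin x)⁻¹ ≤ (x * (1 - x ^ 2 / 6))⁻¹ := inv_anti₀ (by positivity) hs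
  have hne : 6 - x ^ 2 ≠ 0 := by nlinarith
  have hid : (x * (1 - x ^ 2 / 6))⁻¹ - x⁻¹ = x / 6 / (1 - x ^ 2 / 6) := by
    field_simp
    ring
  have hq : x / 6 / (1 - x ^ 2 / 6) ≤ c := (div_le_iff₀ hp).2 h
  linarith

theorem eval_chebyshevU_fifteen (x : ℝ) :
    (Polynomial.Chebyshev.U ℝ 15).eval x =
      32768 * x ^ 15 - 114688 * x ^ 13 + 159744 * x ^ 11 - 112640 * x ^ 9 + 42240 * x ^ 7 -
        8064 * x ^ 5 + 672 * x ^ 3 - 16 * x := by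
  have h (n : ℤ) : (Polynomial.Chebyshev.U ℝ (n + 2)).eval x =
      2 * x * (Polynomial.Chebyshev.U ℝ (n + 1)).eval x -
        (Polynomial.Chebyshev.U ℝ n).eval x := by
    simp [Polynomial.Chebyshev.U_add_two]
  have h0 : (Polynomial.Chebyshev.U ℝ 0).eval x = 1 := by simp
  have h1 : (Polynomial.Chebyshev.U ℝ 1).eval x = 2 * x := by simp
  have h2 := h 0
  have h3 := h 1
  have h4 := h 2
  have h5 := h 3
  have h6 := h 4
  have h7 := h 5
  have h8 := h 6
  have h9 := h 7
  have h10 := h 8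
  have h11 := h 9
  have h12 := h 10
  have h13 := h 11
  have h14 := h 12
  have h15 := h 13
  norm_num only at *
  rw [h15, h14, h13, h12, h11, h10, h9, h8, h7, h6, h5, h4, h3, h2, h1, h0]
  ring

theorem abs_sinc_sub_chebyshevU_lt_of_pos {t : ℝ} (ht0 : 0 < t) (ht : t ≤ 10) :
    |Real.sin t / t -
      (1 / 16) * (Polynomial.Chebyshev.U ℝ 15).eval (Real.cos (t / 16))| < 0.006 := by
  have hx : 0 < t / 16 := by positivity
  have hpi := Real.pi_gt_d2
  have hpi' := Real.pi_lt_d2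
  have hsin : 0 < Real.sin (t / 16) := Real.sin_pos_of_pos_of_lt_pi hx (by linarith)
  have hU : (Polynomial.Chebyshev.U ℝ 15).eval (Real.cos (t / 16)) * Real.sin (t / 16) =
      Real.sin t := by
    rw [Polynomial.Chebyshev.U_real_cos]
    congr 1
    push_cast
    ring
  have hdiff : Real.sin t / t - (1 / 16) * (Polynomial.Chebyshev.U ℝ 15).eval (Real.cos (t / 16)) =
      -(Real.sin t * (((Real.sin (t / 16))⁻¹ - (t / 16)⁻¹) / 16)) := by
    rw [eq_div_of_mul_eq hsin.ne' hU]
    field_simp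
    ring
  have hnonneg : 0 ≤ (Real.sin (t / 16))⁻¹ - (t / 16)⁻¹ :=
    sub_nonneg.2 (inv_anti₀ hsin (Real.sin_le hx.le))
  rw [hdiff, abs_neg, abs_mul, abs_of_nonneg (div_nonneg hnonneg (by norm_num))]
  rcases le_total t 8.7 with h | h
  · have hb := inv_sin_sub_inv_le (c := 0.0955) hx (by linarith) (by
      norm_num at h ⊢
      nlinarith)
    have := mul_le_mul (Real.abs_sin_le_one t)
      (div_le_div_of_nonneg_right hb (by norm_num : (0 : ℝ) ≤ 16))
      (div_nonneg hnonneg (by norm_num)) zero_le_one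
    norm_num at this ⊢
    linarith
  · have hb := inv_sin_sub_inv_le (c := 0.112) hx (by linarith) (by
      norm_num
      nlinarith)
    have hs : |Real.sin t| ≤ 0.75 := by
      have heq : Real.sin t = Real.sin (3 * Real.pi - t) := by
        rw [show 3 * Real.pi - t = Real.pi - t + 2 * Real.pi by ring, Real.sin_add_two_pi,
          Real.sin_pi_sub]
      rw [heq]
      refine Real.abs_sin_le_abs.trans (abs_le.2 ⟨?_, ?_⟩) <;> norm_num at * <;> linarith
    have := mul_le_mul hs
      (div_le_div_of_nonneg_right hb (by norm_num : (0 : ℝ) ≤ 16))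
      (div_nonneg hnonneg (by norm_num)) (by norm_num)
    norm_num at this ⊢
    linarith


theorem sinc_chebyshevU_approx (t : ℝ) (ht : |t| ≤ 10) (ht0 : t ≠ 0) :
    |Real.sin t / t -
        (1 / 16) * (Polynomial.Chebyshev.U ℝ 15).eval (Real.cos (t / 16))| < 0.006 ∧
      (1 / 16) * (Polynomial.Chebyshev.U ℝ 15).eval (Real.cos (t / 16)) =
        2048 * Real.cos (t / 16) ^ 15 - 7168 * Real.cos (t / 16) ^ 13 +
          9984 * Real.cos (t / 16) ^ 11 - 7040 * Real.cos (t / 16) ^ 9 +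
          2640 * Real.cos (t / 16) ^ 7 - 504 * Real.cos (t / 16) ^ 5 +
          42 * Real.cos (t / 16) ^ 3 - Real.cos (t / 16) := by
  constructor
  · rcases lt_or_gt_of_ne ht0 with h | h
    · have := abs_sinc_sub_chebyshevU_lt_of_pos (neg_pos.2 h) ((neg_le_abs t).trans ht)
      rwa [Real.sin_neg, neg_div_neg_eq, neg_div, Real.cos_neg] at this
    · exact abs_sinc_sub_chebyshevU_lt_of_pos h ((le_abs_self t).trans ht)
  · rw [eval_chebyshevU_fifteen]
    ring
end
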